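/- (Deterministic core of Corollary 3.3, mean-square trichotomy.) Assume in addition that Gx does not vanish identically, i.e. there exists t ≥ 0 with Gx(t) ≠ 0 (this corresponds to the assumption that no version of the solution X of the stochastic equation coincides with the deterministic solution x). Then the following three equivalences hold: (i) M(t) → 0 as t → ∞ if and only if ∫₀^∞ g(s) ds < 1; (ii) there exists a constant c ∈ (0,∞) with M(t) → c as t → ∞ if and only if ∫₀^∞ g(s) ds = 1; (iii) M(t) → ∞ as t → ∞ if and only if ∫₀^∞ g(s) ds > 1. -/

import Mathlib

open MeasureTheory Filter Set

/-- Integration of `u ↦ ψ (t + u)` over `[-α, 0]` against a finite signed Borel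
measure `ν`, realised via its Jordan decomposition:
`Gν α ν ψ t = ∫_{[-α,0]} ψ(t+u) ν(du)`. -/
noncomputable def Gν (α : ℝ) (ν : MeasureTheory.SignedMeasure ℝ) (ψ : ℝ → ℝ) (t : ℝ) : ℝ :=
  (∫ u in Set.Icc (-α) 0, ψ (t + u) ∂ν.toJordanDecomposition.posPart) -
  (∫ u in Set.Icc (-α) 0, ψ (t + u) ∂ν.toJordanDecomposition.negPart)


/-- Two nearby positive points of the support. -/
lemma aux_two_points (k : ℝ → ℝ) (hk0 : ∀ s, 0 ≤ k s)
    (hki : Integrable k) (hkneg : ∀ s < 0, k s = 0) (hk1 : ∫ s, k s = 1) (d : ℝ) (hd : 0 < d) :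
    ∃ a b : ℝ, 0 < a ∧ a < b ∧ b < a + d ∧
      (∀ δ > 0, 0 < ∫ s in Ioo (a - δ) (a + δ), k s) ∧
      (∀ δ > 0, 0 < ∫ s in Ioo (b - δ) (b + δ), k s) := by
  set μ : Measure ℝ := volume.withDensity (fun s => ENNReal.ofReal (k s)) with hμ
  have hac : μ ≪ volume := withDensity_absolutelyContinuous _ _
  have hμset : ∀ S : Set ℝ, MeasurableSet S → μ S = ENNReal.ofReal (∫ s in S, k s) := by
    intro S hS
    rw [hμ, withDensity_apply _ hS, ofReal_integral_eq_lintegral_ofReal hki.integrableOn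
      (Eventually.of_forall hk0)]
  have hsupp : ∀ a ∈ μ.support, ∀ δ > 0, 0 < ∫ s in Ioo (a - δ) (a + δ), k s := by
    intro a ha δ hδ
    rw [Measure.mem_support_iff_forall] at ha
    have := ha (Ioo (a - δ) (a + δ)) (Ioo_mem_nhds (by linarith) (by linarith))
    rw [hμset _ measurableSet_Ioo] at this
    exact ENNReal.ofReal_pos.1 this
  by_contra hcon
  have hsub : ∀ n : ℤ, (μ.support ∩ Ioi 0 ∩ {s | ⌊s / d⌋ = n}).Subsingleton := by
    have key : ∀ a b : ℝ, a ∈ μ.support → b ∈ μ.support → 0 < a → a < b → ⌊a / d⌋ = ⌊b / d⌋ →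
        False := by
      intro a b ha hb h0 hab hfl
      refine hcon ⟨a, b, h0, hab, ?_, hsupp a ha, hsupp b hb⟩
      have h1 : (⌊a / d⌋ : ℝ) ≤ a / d := Int.floor_le _
      have h2 : b / d < ⌊b / d⌋ + 1 := Int.lt_floor_add_one _
      rw [← hfl] at h2
      have h3 : b / d < a / d + 1 := by linarith
      rw [div_add_one hd.ne', div_lt_div_iff_of_pos_right hd] at h3
      exact h3
    intro n a ha b hb
    obtain ⟨⟨ha1, ha2⟩, ha3⟩ := ha
    obtain ⟨⟨hb1, hb2⟩, hb3⟩ := hb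
    simp only [mem_ofPred_eq] at ha3 hb3
    rcases lt_trichotomy a b with h | h | h
    · exact (key a b ha1 hb1 ha2 h (ha3.trans hb3.symm)).elim
    · exact h
    · exact (key b a hb1 ha1 hb2 h (hb3.trans ha3.symm)).elim
  have hpiece : μ (⋃ n : ℤ, (μ.support ∩ Ioi 0 ∩ {s | ⌊s / d⌋ = n})) = 0 := by
    rw [measure_iUnion_null_iff]
    intro n
    exact hac ((hsub n).measure_zero _)
  have hneg : μ (Iic 0) = 0 := by
    have : Iic (0:ℝ) = Iio 0 ∪ {0} := by simp
    rw [this]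
    refine measure_union_null ?_ (hac (by simp))
    rw [hμset _ measurableSet_Iio, setIntegral_congr_fun (g := fun _ => 0) measurableSet_Iio
      (fun s hs => hkneg s hs)]
    simp
  have huniv : μ univ = 1 := by
    rw [hμset _ MeasurableSet.univ]; simp [hk1]
  have hc : μ μ.supportᶜ = 0 := Measure.measure_compl_support
  have hle : μ univ = 0 := by
    refine measure_mono_null ?_ (measure_union_null hc (measure_union_null hneg hpiece))
    intro s _
    by_cases h1 : s ∈ μ.support
    · by_cases h2 : s ≤ 0
      · exact Or.inr (Or.inl h2)
      · refine Or.inr (Or.inr (mem_iUnion.2 ⟨⌊s / d⌋, ⟨h1, not_le.1 h2⟩, rfl⟩))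
    · exact Or.inl h1
  rw [huniv] at hle
  exact one_ne_zero hle

/-- Convolution of an integrable kernel against a bounded function with a limit. -/
lemma aux_conv_tendsto (p h : ℝ → ℝ) (hp : Integrable p) (hh : Measurable h) (B c : ℝ)
    (hB : ∀ s, |h s| ≤ B) (hlim : Tendsto h atTop (nhds c)) :
    Tendsto (fun t => ∫ s, p s * h (t - s)) atTop (nhds (c * ∫ s, p s)) := by
  rw [mul_comm, ← integral_mul_const]
  refine tendsto_integral_filter_of_dominated_convergence (fun s => |p s| * B) ?_ ?_ ?_ ?_
  · refine Eventually.of_forall fun t => hp.aestronglyMeasurable.mul ?_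
    exact (hh.comp (measurable_const.sub measurable_id)).aestronglyMeasurable
  · refine Eventually.of_forall fun t => Eventually.of_forall fun s => ?_
    rw [norm_mul]
    exact mul_le_mul_of_nonneg_left (hB _) (norm_nonneg _)
  · exact hp.abs.mul_const B
  · refine Eventually.of_forall fun s => ?_
    refine Tendsto.const_mul _ (hlim.comp ?_)
    exact tendsto_atTop_add_const_right _ _ tendsto_id

/-- sequence version : `q n → 0` pointwise, bounded -/
lemma aux_seq_tendsto (p : ℝ → ℝ) (hp : Integrable p) (q : ℕ → ℝ → ℝ)
    (hq : ∀ n, Measurable (q n)) (B : ℝ) (hB : ∀ n s, |q n s| ≤ B)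
    (hlim : ∀ s, 0 ≤ s → Tendsto (fun n => q n s) atTop (nhds 0)) (hneg : ∀ s < 0, p s = 0) :
    Tendsto (fun n => ∫ s, p s * q n s) atTop (nhds 0) := by
  have : (0:ℝ) = ∫ s : ℝ, (0:ℝ) := by simp
  rw [this]
  refine tendsto_integral_filter_of_dominated_convergence (fun s => |p s| * B) ?_ ?_ ?_ ?_
  · exact Eventually.of_forall fun t => hp.aestronglyMeasurable.mul (hq t).aestronglyMeasurable
  · refine Eventually.of_forall fun t => Eventually.of_forall fun s => ?_
    rw [norm_mul]
    exact mul_le_mul_of_nonneg_left (hB _ _) (norm_nonneg _)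
  · exact hp.abs.mul_const B
  · refine Eventually.of_forall fun s => ?_
    by_cases hs : 0 ≤ s
    · simpa using (hlim s hs).const_mul (p s)
    · simp [hneg s (not_le.1 hs)]

lemma aux_int_mul (p h : ℝ → ℝ) (hp : Integrable p) (hh : Measurable h) (B : ℝ)
    (hB : ∀ s, |h s| ≤ B) : Integrable (fun s => p s * h s) :=
  hp.mul_bdd (c := B) hh.aestronglyMeasurable (Eventually.of_forall hB)

/-- Propagation of the limsup along the support. -/
lemma aux_propagate (k w : ℝ → ℝ) (hk0 : ∀ s, 0 ≤ k s)
    (hki : Integrable k) (hkneg : ∀ s < 0, k s = 0) (hk1 : ∫ s, k s = 1)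
    (hwm : Measurable w) (huc : UniformContinuous w) (B : ℝ) (hB : ∀ s, |w s| ≤ B)
    (hharm : Tendsto (fun t => w t - ∫ s, k s * w (t - s)) atTop (nhds 0))
    (L : ℝ) (hL : ∀ b > L, ∀ᶠ t in atTop, w t < b)
    (a : ℝ) (ha : ∀ δ > 0, 0 < ∫ s in Ioo (a - δ) (a + δ), k s)
    (t : ℕ → ℝ) (ht : Tendsto t atTop atTop) (hw : Tendsto (fun n => w (t n)) atTop (nhds L)) :
    Tendsto (fun n => w (t n - a)) atTop (nhds L) := by
  have hsh : ∀ n, Measurable (fun s => w (t n - s)) := fun n =>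
    hwm.comp (measurable_const.sub measurable_id)
  have hpos : Tendsto (fun n => ∫ s, k s * max (w (t n - s) - L) 0) atTop (nhds 0) := by
    refine aux_seq_tendsto k hki _ (fun n => ((hsh n).sub_const L).max measurable_const)
      (B + |L|) ?_ ?_ hkneg
    · intro n s
      have h1 := abs_le.1 (hB (t n - s))
      have h2 := neg_abs_le L
      have h3 := le_abs_self L
      rw [abs_of_nonneg (le_max_right _ _)]
      refine max_le (by linarith) (by linarith [abs_nonneg L])
    · intro s _
      rw [Metric.tendsto_nhds]
      intro ε hε
      have hts : Tendsto (fun n => t n - s) atTop atTop :=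
        tendsto_atTop_add_const_right _ _ ht
      filter_upwards [hts.eventually (hL (L + ε) (by linarith))] with n hn
      rw [Real.dist_eq, sub_zero, abs_of_nonneg (le_max_right _ _)]
      exact max_lt (by linarith) hε
  have hlin : Tendsto (fun n => ∫ s, k s * (w (t n - s) - L)) atTop (nhds 0) := by
    have h1 : ∀ n, ∫ s, k s * (w (t n - s) - L) =
        w (t n) - L - (w (t n) - ∫ s, k s * w (t n - s)) := by
      intro n
      simp_rw [mul_sub]
      rw [integral_sub (aux_int_mul k _ hki (hsh n) B (fun s => hB _)) (hki.mul_const L),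
        integral_mul_const, hk1]
      ring
    simp_rw [h1]
    have := (hw.sub_const L).sub (hharm.comp ht)
    simpa using this
  have habs : Tendsto (fun n => ∫ s, k s * |w (t n - s) - L|) atTop (nhds 0) := by
    have h1 : ∀ n, ∫ s, k s * |w (t n - s) - L| =
        2 * (∫ s, k s * max (w (t n - s) - L) 0) - ∫ s, k s * (w (t n - s) - L) := by
      intro n
      rw [← integral_const_mul, ← integral_sub]
      · congr 1; ext s
        rcases le_total 0 (w (t n - s) - L) with h | h
        · rw [abs_of_nonneg h, max_eq_left h]; ring
        · rw [abs_of_nonpos h, max_eq_right h]; ring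
      · refine (aux_int_mul k _ hki (((hsh n).sub_const L).max measurable_const) (B + |L|)
          ?_).const_mul 2
        intro s
        have h1 := abs_le.1 (hB (t n - s))
        have h2 := neg_abs_le L
        have h3 := le_abs_self L
        rw [abs_of_nonneg (le_max_right _ _)]
        refine max_le (by linarith) (by linarith [abs_nonneg L])
      · refine aux_int_mul k _ hki ((hsh n).sub_const L) (B + |L|) ?_
        intro s
        exact (abs_sub _ _).trans (add_le_add (hB _) le_rfl)
    simp_rw [h1]
    simpa using (hpos.const_mul 2).sub hlin
  rw [Metric.tendsto_nhds]
  intro ε hε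
  obtain ⟨δ, hδ, hδ'⟩ := Metric.uniformContinuous_iff.1 huc (ε / 2) (half_pos hε)
  have hp := ha δ hδ
  set p := ∫ s in Ioo (a - δ) (a + δ), k s with hpdef
  filter_upwards [(tendsto_order.1 habs).2 (ε / 2 * p) (by positivity)] with n hn
  by_contra hcon
  rw [not_lt, Real.dist_eq] at hcon
  have hInt : Integrable (fun s => k s * |w (t n - s) - L|) := by
    refine aux_int_mul k _ hki ((hsh n).sub_const L).abs (B + |L|) ?_
    intro s
    rw [abs_abs]
    exact (abs_sub _ _).trans (add_le_add (hB _) le_rfl)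
  have h1 : ε / 2 * p ≤ ∫ s in Ioo (a - δ) (a + δ), k s * |w (t n - s) - L| := by
    rw [hpdef, ← integral_const_mul]
    refine setIntegral_mono_on (hki.integrableOn.const_mul _) hInt.integrableOn
      measurableSet_Ioo ?_
    intro s hs
    rw [mul_comm]
    refine mul_le_mul_of_nonneg_left ?_ (hk0 s)
    have h2 : dist (t n - s) (t n - a) < δ := by
      rw [Real.dist_eq, abs_lt]
      constructor <;> linarith [hs.1, hs.2]
    have h3 := hδ' h2
    rw [Real.dist_eq] at h3
    have h4 : |w (t n - a) - L| ≤ |w (t n - s) - w (t n - a)| + |w (t n - s) - L| := by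
      rw [abs_sub_comm (w (t n - s)) (w (t n - a))]
      exact abs_sub_le _ _ _
    linarith
  have h2 := setIntegral_le_integral (s := Ioo (a - δ) (a + δ)) hInt
    (Eventually.of_forall fun s => mul_nonneg (hk0 s) (abs_nonneg _))
  linarith

lemma aux_limsup (k κ w : ℝ → ℝ) (hkm : Measurable k) (hk0 : ∀ s, 0 ≤ k s)
    (hki : Integrable k) (hkneg : ∀ s < 0, k s = 0) (hk1 : ∫ s, k s = 1)
    (hκ0 : ∀ s, 0 ≤ κ s) (hκi : Integrable κ) (hκneg : ∀ s < 0, κ s = 0)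
    (hκpos : 0 < ∫ s, κ s)
    (hwm : Measurable w) (huc : UniformContinuous w) (B : ℝ) (hB : ∀ s, |w s| ≤ B)
    (hharm : Tendsto (fun t => w t - ∫ s, k s * w (t - s)) atTop (nhds 0))
    (Γ : ℝ) (hΓ : Tendsto (fun t => ∫ s, κ s * w (t - s)) atTop (nhds Γ)) :
    ∀ b > Γ / ∫ s, κ s, ∀ᶠ t in atTop, w t < b := by
  have hbd : IsBoundedUnder (· ≤ ·) atTop w :=
    isBoundedUnder_of ⟨B, fun s => (abs_le.1 (hB s)).2⟩
  have hbd' : IsBoundedUnder (· ≥ ·) atTop w :=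
    isBoundedUnder_of ⟨-B, fun s => (abs_le.1 (hB s)).1⟩
  have hcob : IsCoboundedUnder (· ≤ ·) atTop w := hbd'.isCoboundedUnder_le
  set L := limsup w atTop with hLdef
  have hL : ∀ b > L, ∀ᶠ t in atTop, w t < b := fun b hb => eventually_lt_of_limsup_lt hb hbd
  obtain ⟨t, htw, ht⟩ := exists_seq_tendsto_limsup hcob hbd
  rw [← hLdef] at htw
  -- main estimate
  have main : ∀ ε > 0, |Γ - L * ∫ s, κ s| ≤ ε * ∫ s, κ s := by
    intro ε hε
    obtain ⟨d, hd, hd'⟩ := Metric.uniformContinuous_iff.1 huc (ε / 2) (half_pos hε)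
    obtain ⟨a, b, ha0, hab, hbd, ha, hb⟩ := aux_two_points k hk0 hki hkneg hk1 d hd
    have hprop : ∀ e : ℝ, (∀ δ > 0, 0 < ∫ s in Ioo (e - δ) (e + δ), k s) →
      ∀ u : ℕ → ℝ, Tendsto u atTop atTop → Tendsto (fun n => w (u n)) atTop (nhds L) →
      ∀ i : ℕ, Tendsto (fun n => w (u n - i * e)) atTop (nhds L) := by
      intro e he u hu huw i
      induction i with
      | zero => simpa using huw
      | succ i ih =>
        have := aux_propagate k w hk0 hki hkneg hk1 hwm huc B hB hharm L hL e he
          (fun n => u n - i * e) (tendsto_atTop_add_const_right _ _ hu) ih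
        refine this.congr fun n => ?_
        congr 1; push_cast; ring
    have hsem : ∀ i j : ℕ, Tendsto (fun n => w (t n - (i * a + j * b))) atTop (nhds L) := by
      intro i j
      have := hprop b hb (fun n => t n - i * a) (tendsto_atTop_add_const_right _ _ ht)
        (hprop a ha t ht htw i) j
      refine this.congr fun n => ?_
      congr 1; ring
    obtain ⟨n0, hn0⟩ := exists_nat_ge (a / (b - a))
    have hba : 0 < b - a := by linarith
    rw [div_le_iff₀ hba] at hn0
    set A := (n0 : ℝ) * a with hA
    have hnet : ∀ x, A ≤ x → ∃ i j : ℕ, |x - (i * a + j * b)| < d := by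
      intro x hx
      have hx0 : 0 ≤ x := le_trans (by positivity) hx
      set m := ⌊x / a⌋₊ with hm
      have hm1 : (m : ℝ) * a ≤ x := by
        have := Nat.floor_le (div_nonneg hx0 ha0.le)
        rwa [le_div_iff₀ ha0] at this
      have hm2 : x < (m + 1) * a := by
        have := Nat.lt_floor_add_one (x / a)
        rwa [div_lt_iff₀ ha0] at this
      have hm3 : n0 ≤ m := by
        apply Nat.le_floor
        rw [le_div_iff₀ ha0]; exact hx
      have hy0 : 0 ≤ x - m * a := by linarith
      set j := ⌊(x - m * a) / (b - a)⌋₊ with hj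
      have hj1 : (j : ℝ) * (b - a) ≤ x - m * a := by
        have := Nat.floor_le (div_nonneg hy0 hba.le)
        rwa [le_div_iff₀ hba] at this
      have hj2 : x - m * a < (j + 1) * (b - a) := by
        have := Nat.lt_floor_add_one ((x - m * a) / (b - a))
        rwa [div_lt_iff₀ hba] at this
      have hjm : j ≤ m := by
        refine le_trans ?_ hm3
        have h1 : (j : ℝ) * (b - a) ≤ n0 * (b - a) := by nlinarith
        exact_mod_cast le_of_mul_le_mul_right h1 hba
      refine ⟨m - j, j, ?_⟩
      rw [Nat.cast_sub hjm, abs_lt]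
      constructor <;> nlinarith
    set u : ℕ → ℝ := fun n => t n - A with hu
    have hut : Tendsto u atTop atTop := tendsto_atTop_add_const_right _ _ ht
    have hsh : ∀ n, Measurable (fun s => w (u n - s)) := fun n =>
      hwm.comp (measurable_const.sub measurable_id)
    have hbdd1 : ∀ n s, |w (u n - s) - L| ≤ B + |L| := fun n s =>
      (abs_sub _ _).trans (add_le_add (hB _) le_rfl)
    have hq : Tendsto (fun n => ∫ s, κ s * max (|w (u n - s) - L| - ε) 0) atTop (nhds 0) := by
      refine aux_seq_tendsto κ hκi _
        (fun n => ((((hsh n).sub_const L).abs).sub_const ε).max measurable_const)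
        (B + |L|) ?_ ?_ hκneg
      · intro n s
        rw [abs_of_nonneg (le_max_right _ _)]
        have := hbdd1 n s
        refine max_le (by linarith) ((abs_nonneg _).trans this)
      · intro s hs
        obtain ⟨i, j, hij⟩ := hnet (A + s) (by linarith)
        refine tendsto_const_nhds.congr' ?_
        filter_upwards [Metric.tendsto_nhds.1 (hsem i j) (ε / 2) (half_pos hε)] with n hn
        symm
        apply max_eq_right
        rw [Real.dist_eq] at hn
        have h2 : dist (u n - s) (t n - (i * a + j * b)) < d := by
          rw [Real.dist_eq, ← abs_neg]
          convert hij using 2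
          simp only [hu]; ring
        have h3 := hd' h2
        rw [Real.dist_eq] at h3
        have := abs_sub_le (w (u n - s)) (w (t n - (i * a + j * b))) L
        linarith
    have hle : ∀ n, |(∫ s, κ s * w (u n - s)) - L * ∫ s, κ s| ≤
        ε * (∫ s, κ s) + ∫ s, κ s * max (|w (u n - s) - L| - ε) 0 := by
      intro n
      have hi1 : Integrable (fun s => κ s * max (|w (u n - s) - L| - ε) 0) := by
        refine aux_int_mul κ _ hκi ((((hsh n).sub_const L).abs).sub_const ε |>.max measurable_const)
          (B + |L|) ?_
        intro s
        rw [abs_of_nonneg (le_max_right _ _)]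
        have := hbdd1 n s
        refine max_le (by linarith) ((abs_nonneg _).trans this)
      rw [mul_comm L, mul_comm ε, ← integral_mul_const, ← integral_mul_const, ← integral_sub
        (aux_int_mul κ _ hκi (hsh n) B (fun s => hB _)) (hκi.mul_const L),
        ← integral_add (hκi.mul_const ε) hi1]
      rw [← Real.norm_eq_abs]
      refine norm_integral_le_of_norm_le ((hκi.mul_const ε).add hi1) ?_
      refine Eventually.of_forall fun s => ?_
      rw [← mul_sub, norm_mul, Real.norm_of_nonneg (hκ0 s), Real.norm_eq_abs, ← mul_add]
      refine mul_le_mul_of_nonneg_left ?_ (hκ0 s)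
      linarith [le_max_left (|w (u n - s) - L| - ε) 0]
    have hl := ((hΓ.comp hut).sub_const (L * ∫ s, κ s)).abs
    have hr := hq.const_add (ε * ∫ s, κ s)
    rw [add_zero] at hr
    exact le_of_tendsto_of_tendsto' hl hr hle
  have heq : Γ = L * ∫ s, κ s := by
    have h0 : |Γ - L * ∫ s, κ s| ≤ 0 := by
      by_contra hcon
      rw [not_le] at hcon
      have := main (|Γ - L * ∫ s, κ s| / (2 * ∫ s, κ s)) (by positivity)
      have h2 : |Γ - L * ∫ s, κ s| / (2 * ∫ s, κ s) * ∫ s, κ s = |Γ - L * ∫ s, κ s| / 2 := by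
        field_simp
      rw [h2] at this
      linarith
    have := abs_eq_zero.1 (le_antisymm h0 (abs_nonneg _))
    linarith
  rw [heq, mul_div_cancel_right₀ _ hκpos.ne']
  exact hL

lemma aux_limit (k κ w : ℝ → ℝ) (hkm : Measurable k) (hk0 : ∀ s, 0 ≤ k s)
    (hki : Integrable k) (hkneg : ∀ s < 0, k s = 0) (hk1 : ∫ s, k s = 1)
    (hκ0 : ∀ s, 0 ≤ κ s) (hκi : Integrable κ) (hκneg : ∀ s < 0, κ s = 0)
    (hκpos : 0 < ∫ s, κ s)
    (hwm : Measurable w) (huc : UniformContinuous w) (B : ℝ) (hB : ∀ s, |w s| ≤ B)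
    (hharm : Tendsto (fun t => w t - ∫ s, k s * w (t - s)) atTop (nhds 0))
    (Γ : ℝ) (hΓ : Tendsto (fun t => ∫ s, κ s * w (t - s)) atTop (nhds Γ)) :
    Tendsto w atTop (nhds (Γ / ∫ s, κ s)) := by
  rw [tendsto_order]
  refine ⟨fun b hb => ?_, aux_limsup k κ w hkm hk0 hki hkneg hk1 hκ0 hκi hκneg hκpos hwm huc B hB hharm Γ hΓ⟩
  have hwuc : UniformContinuous (fun t => - w t) := huc.neg
  have := aux_limsup k κ (fun t => - w t) hkm hk0 hki hkneg hk1 hκ0 hκi hκneg hκpos hwm.neg (hwuc)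
    B (fun s => by rw [abs_neg]; exact hB s)
    (by
      have := hharm.neg
      simp only [neg_zero] at this
      refine this.congr fun t => ?_
      simp_rw [mul_neg]; rw [integral_neg (μ := volume)]; ring) (-Γ)
    (by
      refine hΓ.neg.congr fun t => ?_
      simp only [mul_neg, integral_neg]) (-b) (by rw [neg_div]; linarith)
  filter_upwards [this] with t ht
  linarith

lemma aux_shift_tendsto (k : ℝ → ℝ) (hki : Integrable k) :
    ∀ ε > 0, ∃ δ > 0, ∀ h : ℝ, |h| < δ → ∫ u, |k (u + h) - k u| ≤ ε := by
  intro ε hε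
  obtain ⟨g, hgs, hg, hgc, hgi⟩ := hki.exists_hasCompactSupport_integral_sub_le
    (show 0 < ε / 4 by linarith)
  obtain ⟨R, hR⟩ := hgs.isCompact.isBounded.subset_closedBall 0
  have hzero : ∀ u, R < |u| → g u = 0 := by
    intro u hu
    by_contra hne
    have := hR (subset_tsupport g (Function.mem_support.2 hne))
    simp only [Metric.mem_closedBall, dist_zero_right, Real.norm_eq_abs] at this
    linarith
  obtain ⟨S, hS⟩ := hgs.exists_bound_of_continuous hgc
  have ht : Tendsto (fun h : ℝ => ∫ u, |g (u + h) - g u|) (nhds 0) (nhds (∫ u : ℝ, (0:ℝ))) := by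
    refine tendsto_integral_filter_of_dominated_convergence
      ((Icc (-(R + 1)) (R + 1)).indicator fun _ => 2 * S) ?_ ?_ ?_ ?_
    · exact Eventually.of_forall fun h => (by fun_prop : Continuous _).aestronglyMeasurable
    · filter_upwards [Metric.ball_mem_nhds (0:ℝ) one_pos] with h hh
      refine Eventually.of_forall fun u => ?_
      simp only [Metric.mem_ball, dist_zero_right, Real.norm_eq_abs] at hh
      rw [Real.norm_eq_abs, abs_abs]
      by_cases hu : u ∈ Icc (-(R + 1)) (R + 1)
      · rw [indicator_of_mem hu]
        have h1 := hS (u + h)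
        have h2 := hS u
        rw [Real.norm_eq_abs] at h1 h2
        have := abs_sub (g (u + h)) (g u)
        linarith
      · rw [indicator_of_notMem hu]
        have hu' : R + 1 < |u| := by
          by_contra hcon
          exact hu (abs_le.1 (not_lt.1 hcon))
        have h3 : |u| ≤ |u + h| + |h| := by
          have := abs_sub (u + h) h
          simpa using this
        rw [hzero u (by linarith), hzero (u + h) (by linarith)]
        simp
    · rw [integrable_indicator_iff measurableSet_Icc]
      exact integrableOn_const (by simp)
    · refine Eventually.of_forall fun u => ?_
      have : Continuous fun h : ℝ => |g (u + h) - g u| := by fun_prop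
      simpa using this.tendsto 0
  rw [integral_zero] at ht
  obtain ⟨δ, hδ, hδ'⟩ := Metric.tendsto_nhds_nhds.1 ht (ε / 4) (by linarith)
  refine ⟨δ, hδ, fun h hh => ?_⟩
  have h1 := hδ' (x := h) (by simpa using hh)
  rw [Real.dist_eq, sub_zero] at h1
  have h1' := (abs_lt.1 h1).2
  have hkg : Integrable (fun u => |k u - g u|) := (hki.sub hgi).abs
  have hkgh : Integrable (fun u => |k (u + h) - g (u + h)|) := hkg.comp_add_right h
  have hgg : Integrable (fun u => |g (u + h) - g u|) := ((hgi.comp_add_right h).sub hgi).abs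
  have h2 : ∫ u, |k (u + h) - k u| ≤ ∫ u, (|k (u + h) - g (u + h)| + |g (u + h) - g u| +
      |k u - g u|) := by
    refine integral_mono (((hki.comp_add_right h).sub hki).abs) ((hkgh.add hgg).add hkg) ?_
    intro u
    have e1 := abs_sub_le (k (u + h)) (g (u + h)) (k u)
    have e2 := abs_sub_le (g (u + h)) (g u) (k u)
    rw [abs_sub_comm (g u) (k u)] at e2
    simp only
    linarith
  rw [integral_add (by exact hkgh.add hgg) hkg, integral_add hkgh hgg,
    integral_add_right_eq_self (fun u => |k u - g u|) h] at h2
  simp only [Real.norm_eq_abs] at hg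
  linarith

lemma aux_conv_uc (k z : ℝ → ℝ) (hki : Integrable k) (hz : Measurable z) (B : ℝ)
    (hB : ∀ s, |z s| ≤ B) : UniformContinuous (fun t => ∫ s, k s * z (t - s)) := by
  rw [Metric.uniformContinuous_iff]
  intro ε hε
  have hB0 : 0 ≤ B := (abs_nonneg _).trans (hB 0)
  obtain ⟨δ, hδ, hδ'⟩ := aux_shift_tendsto k hki (ε / (2 * (B + 1))) (by positivity)
  refine ⟨δ, hδ, fun {a b} hab => ?_⟩
  rw [Real.dist_eq] at hab ⊢
  have hsw : ∀ t, ∫ s, k s * z (t - s) = ∫ s, k (t - s) * z s := by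
    intro t
    rw [← integral_sub_left_eq_self _ volume t]
    simp
  have hi : ∀ t, Integrable (fun s => k (t - s) * z s) := fun t =>
    (hki.comp_sub_left t).mul_bdd (c := B) hz.aestronglyMeasurable (Eventually.of_forall hB)
  have hsub : Integrable (fun s => |k (a - s) - k (b - s)|) :=
    ((hki.comp_sub_left a).sub (hki.comp_sub_left b)).abs
  rw [hsw, hsw, ← integral_sub (hi a) (hi b)]
  have h1 : ‖∫ s, (k (a - s) * z s - k (b - s) * z s)‖ ≤ ∫ s, |k (a - s) - k (b - s)| * B := by
    refine norm_integral_le_of_norm_le (hsub.mul_const B) (Eventually.of_forall fun s => ?_)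
    rw [← sub_mul, norm_mul]
    exact mul_le_mul_of_nonneg_left (hB s) (norm_nonneg _)
  rw [integral_mul_const] at h1
  have h2 : ∫ s, |k (a - s) - k (b - s)| = ∫ u, |k (u + (a - b)) - k u| := by
    rw [← integral_sub_left_eq_self _ volume b]
    congr 1; ext u
    congr 3 <;> ring_nf
  rw [h2] at h1
  have h3 := hδ' (a - b) hab
  rw [Real.norm_eq_abs] at h1
  have h4 : (∫ u, |k (u + (a - b)) - k u|) * B ≤ ε / (2 * (B + 1)) * B :=
    mul_le_mul_of_nonneg_right h3 hB0
  have h5 : ε / (2 * (B + 1)) * B < ε := by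
    rw [div_mul_eq_mul_div, div_lt_iff₀ (by positivity)]
    nlinarith
  linarith

/-- integrated renewal equation -/
lemma aux_Z1 (k z φ : ℝ → ENNReal) (hk : Measurable k) (hz : Measurable z) (hφ : Measurable φ)
    (hren : ∀ t, z t = φ t + ∫⁻ s, k s * z (t - s)) (t : ℝ) :
    ∫⁻ u in Ici 0, z (t - u) = (∫⁻ u in Ici 0, φ (t - u)) +
      ∫⁻ s, k s * ∫⁻ u in Ici 0, z (t - s - u) := by
  have h1 : ∫⁻ u in Ici 0, z (t - u) = ∫⁻ u in Ici 0, (φ (t - u) + ∫⁻ s, k s * z (t - u - s)) := by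
    congr 1; ext u; exact hren _
  rw [h1, lintegral_add_left (by fun_prop), lintegral_lintegral_swap (by fun_prop)]
  congr 2; ext s
  rw [lintegral_const_mul _ (by fun_prop)]
  congr 2; ext u; congr 1; ring

lemma aux_Z2 (k z : ℝ → ENNReal) (hk : Measurable k) (hz : Measurable z)
    (hkneg : ∀ s < 0, k s = 0) (t : ℝ) :
    (∫⁻ s in Ici 0, (∫⁻ w in Ioi s, k w) * z (t - s)) +
      ∫⁻ w, k w * ∫⁻ u in Ici 0, z (t - w - u) = (∫⁻ w, k w) * ∫⁻ u in Ici 0, z (t - u) := by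
  set S : Set (ℝ × ℝ) := {p | p.1 < p.2} with hS
  have hSm : MeasurableSet S := measurableSet_lt measurable_fst measurable_snd
  have hFm : Measurable (S.indicator (fun p : ℝ × ℝ => k p.2 * z (t - p.1))) :=
    Measurable.indicator (by fun_prop) hSm
  have h1 : ∀ s, (∫⁻ w in Ioi s, k w) * z (t - s) =
      ∫⁻ w, S.indicator (fun p : ℝ × ℝ => k p.2 * z (t - p.1)) (s, w) := by
    intro s
    rw [← lintegral_mul_const _ hk, ← lintegral_indicator measurableSet_Ioi]
    congr 1
  simp_rw [h1]
  rw [lintegral_lintegral_swap (by exact hFm.aemeasurable), ← lintegral_add_right, ← lintegral_mul_const _ hk]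
  · congr 1; ext w
    by_cases hw : w < 0
    · rw [hkneg w hw]
      simp only [zero_mul, add_zero]
      refine (lintegral_congr fun s => ?_).trans lintegral_zero
      by_cases hs : (s, w) ∈ S
      · rw [indicator_of_mem hs]; simp [hkneg w hw]
      · rw [indicator_of_notMem hs]
    · rw [not_lt] at hw
      have h2 : ∫⁻ s in Ici 0, S.indicator (fun p : ℝ × ℝ => k p.2 * z (t - p.1)) (s, w) =
          k w * ∫⁻ s in Ici 0, (Iio w).indicator (fun s => z (t - s)) s := by
        rw [← lintegral_const_mul _ (Measurable.indicator (by fun_prop) measurableSet_Iio)]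
        congr 1; ext s
        by_cases hs : s < w
        · rw [indicator_of_mem (show s ∈ Iio w from hs), indicator_of_mem (show (s, w) ∈ S from hs)]
        · rw [indicator_of_notMem (show s ∉ Iio w from hs),
            indicator_of_notMem (show (s, w) ∉ S from hs), mul_zero]
      rw [h2, ← mul_add]
      congr 1
      have h3 : ∫⁻ u in Ici 0, z (t - w - u) = ∫⁻ u in Ici w, z (t - u) := by
        rw [← lintegral_indicator measurableSet_Ici, ← lintegral_indicator measurableSet_Ici,
          ← lintegral_add_right_eq_self ((Ici w).indicator fun u => z (t - u)) w]
        congr 1; ext u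
        by_cases hu : 0 ≤ u
        · rw [indicator_of_mem (show u ∈ Ici 0 from hu),
            indicator_of_mem (show u + w ∈ Ici w by simpa using hu)]
          congr 1; ring
        · rw [indicator_of_notMem (show u ∉ Ici 0 from hu),
            indicator_of_notMem (show u + w ∉ Ici w by simpa using hu)]
      rw [h3, setLIntegral_indicator measurableSet_Iio]
      have h4 : Ici (0:ℝ) = (Iio w ∩ Ici 0) ∪ Ici w := by
        ext s; simp only [mem_union, mem_inter_iff, mem_Iio, mem_Ici]
        constructor
        · intro h; rcases lt_or_ge s w with h' | h'
          · exact Or.inl ⟨h', h⟩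
          · exact Or.inr h'
        · rintro (h | h)
          · exact h.2
          · exact hw.trans h
      conv_rhs => rw [h4]
      rw [lintegral_union measurableSet_Ici]
      rw [Set.disjoint_left]
      intro s hs hs'
      exact (not_lt.2 (show w ≤ s from hs')) hs.1
  · refine hk.mul ?_
    exact Measurable.lintegral_prod_right (f := fun p u : ℝ => z (t - p - u)) (by fun_prop)

lemma aux_exp_int (p : ℝ → ℝ) (hp : Measurable p) (K γ : ℝ) (hγ : 0 < γ)
    (hpneg : ∀ s < 0, p s = 0) (hb : ∀ s ≥ 0, |p s| ≤ K * Real.exp (-γ * s)) : Integrable p := by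
  have h1 : IntegrableOn (fun s => K * Real.exp (-γ * s)) (Ici 0) :=
    (integrableOn_Ici_iff_integrableOn_Ioi).2
      ((integrableOn_exp_mul_Ioi (neg_lt_zero.2 hγ) 0).const_mul K)
  rw [← integrable_indicator_iff measurableSet_Ici] at h1
  refine h1.mono' hp.aestronglyMeasurable (Eventually.of_forall fun s => ?_)
  by_cases hs : 0 ≤ s
  · rw [indicator_of_mem (show s ∈ Ici 0 from hs)]; exact hb s hs
  · rw [indicator_of_notMem (show s ∉ Ici 0 from hs), hpneg s (not_le.1 hs)]; simp

lemma aux_exp_bdd (p : ℝ → ℝ) (K γ : ℝ) (hγ : 0 < γ) (hK : 0 ≤ K)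
    (hpneg : ∀ s < 0, p s = 0) (hb : ∀ s ≥ 0, |p s| ≤ K * Real.exp (-γ * s)) (s : ℝ) :
    |p s| ≤ K := by
  by_cases hs : 0 ≤ s
  · refine (hb s hs).trans ?_
    have : Real.exp (-γ * s) ≤ 1 := Real.exp_le_one_iff.2 (by nlinarith)
    nlinarith
  · rw [hpneg s (not_le.1 hs)]; simpa using hK

lemma aux_exp_lim (p : ℝ → ℝ) (K γ : ℝ) (hγ : 0 < γ)
    (hb : ∀ s ≥ 0, |p s| ≤ K * Real.exp (-γ * s)) : Tendsto p atTop (nhds 0) := by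
  have h1 : Tendsto (fun s : ℝ => K * Real.exp (-γ * s)) atTop (nhds 0) := by
    have h2 : Tendsto (fun s : ℝ => -γ * s) atTop atBot :=
      tendsto_id.const_mul_atTop_of_neg (neg_lt_zero.2 hγ)
    simpa using (Real.tendsto_exp_atBot.comp h2).const_mul K
  refine squeeze_zero_norm' ?_ h1
  filter_upwards [eventually_ge_atTop 0] with s hs using hb s hs

/-- ENNReal version of the renewal equation. -/
lemma aux_ennren (k φ z : ℝ → ℝ) (hk0 : ∀ s, 0 ≤ k s) (hki : Integrable k)
    (hkneg : ∀ s < 0, k s = 0) (hφ0 : ∀ s, 0 ≤ φ s) (hzm : Measurable z) (hz0 : ∀ s, 0 ≤ z s)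
    (hzb : ∀ T : ℝ, ∃ B : ℝ, ∀ t ≤ T, z t ≤ B)
    (hren : ∀ t, z t = φ t + ∫ s, k s * z (t - s)) (t : ℝ) :
    Integrable (fun s => k s * z (t - s)) ∧
    ENNReal.ofReal (z t) = ENNReal.ofReal (φ t) +
      ∫⁻ s, ENNReal.ofReal (k s) * ENNReal.ofReal (z (t - s)) := by
  obtain ⟨B, hB⟩ := hzb t
  have hInt : Integrable (fun s => k s * z (t - s)) := by
    refine (hki.mul_const B).mono' (hki.aestronglyMeasurable.mul
      (hzm.comp (measurable_const.sub measurable_id)).aestronglyMeasurable)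
      (Eventually.of_forall fun s => ?_)
    rw [norm_mul, Real.norm_of_nonneg (hk0 s), Real.norm_of_nonneg (hz0 _)]
    by_cases hs : 0 ≤ s
    · exact mul_le_mul_of_nonneg_left (hB _ (by linarith)) (hk0 s)
    · rw [hkneg s (not_le.1 hs)]; simp
  refine ⟨hInt, ?_⟩
  rw [hren t, ENNReal.ofReal_add (hφ0 t) (integral_nonneg fun s => mul_nonneg (hk0 s) (hz0 _)),
    ofReal_integral_eq_lintegral_ofReal hInt
      (Eventually.of_forall fun s => mul_nonneg (hk0 s) (hz0 _))]
  congr 2; ext s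
  rw [ENNReal.ofReal_mul (hk0 s)]

lemma aux_Zfin (z : ℝ → ℝ) (hzneg : ∀ s < 0, z s = 0)
    (hzb : ∀ T : ℝ, ∃ B : ℝ, ∀ t ≤ T, z t ≤ B) (t : ℝ) :
    ∫⁻ u in Ici 0, ENNReal.ofReal (z (t - u)) ≠ ⊤ := by
  obtain ⟨B, hB⟩ := hzb t
  have h1 : ∫⁻ u in Ici 0, ENNReal.ofReal (z (t - u)) ≤
      ∫⁻ u in Ici 0, (Iic t).indicator (fun _ => ENNReal.ofReal B) u := by
    refine setLIntegral_mono' measurableSet_Ici fun u hu => ?_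
    by_cases hut : u ≤ t
    · rw [indicator_of_mem (show u ∈ Iic t from hut)]
      exact ENNReal.ofReal_le_ofReal (hB _ (by linarith [show (0:ℝ) ≤ u from hu]))
    · rw [hzneg _ (by linarith)]; simp
  refine ne_top_of_le_ne_top ?_ h1
  rw [setLIntegral_indicator measurableSet_Iic, setLIntegral_const, inter_comm, Ici_inter_Iic]
  simp [ENNReal.mul_eq_top]

lemma aux_phi_le (φ : ℝ → ℝ) (hφ0 : ∀ s, 0 ≤ φ s) (hφi : Integrable φ)
    (t : ℝ) : ∫⁻ u in Ici 0, ENNReal.ofReal (φ (t - u)) ≤ ENNReal.ofReal (∫ s, φ s) := by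
  rw [ofReal_integral_eq_lintegral_ofReal hφi (Eventually.of_forall hφ0)]
  refine (setLIntegral_le_lintegral _ _).trans (le_of_eq ?_)
  exact lintegral_sub_left_eq_self (fun s => ENNReal.ofReal (φ s)) t

/-- Subcritical case: the solution is integrable. -/
lemma aux_sub (k φ z : ℝ → ℝ) (hkm : Measurable k) (hk0 : ∀ s, 0 ≤ k s) (hki : Integrable k)
    (hkneg : ∀ s < 0, k s = 0) (hk1 : ∫ s, k s < 1)
    (hφm : Measurable φ) (hφ0 : ∀ s, 0 ≤ φ s) (hφi : Integrable φ)
    (hzm : Measurable z) (hz0 : ∀ s, 0 ≤ z s) (hzneg : ∀ s < 0, z s = 0)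
    (hzb : ∀ T : ℝ, ∃ B : ℝ, ∀ t ≤ T, z t ≤ B)
    (hren : ∀ t, z t = φ t + ∫ s, k s * z (t - s)) : Integrable z := by
  set Z : ℝ → ENNReal := fun t => ∫⁻ u in Ici 0, ENNReal.ofReal (z (t - u)) with hZ
  have hfin : ∀ t, Z t ≠ ⊤ := aux_Zfin z hzneg hzb
  have hIic : ∀ t, Z t = ∫⁻ u in Iic t, ENNReal.ofReal (z u) := by
    intro t
    simp only [hZ]
    rw [← lintegral_indicator measurableSet_Ici, ← lintegral_indicator measurableSet_Iic,
      ← lintegral_sub_left_eq_self ((Iic t).indicator fun u => ENNReal.ofReal (z u)) t]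
    congr 1; ext u
    by_cases hu : 0 ≤ u
    · rw [indicator_of_mem (show u ∈ Ici 0 from hu),
        indicator_of_mem (show t - u ∈ Iic t by simpa using hu)]
    · rw [indicator_of_notMem (show u ∉ Ici 0 from hu),
        indicator_of_notMem (show t - u ∉ Iic t by simpa using hu)]
  have hmono : Monotone Z := by
    intro a b hab
    rw [hIic, hIic]
    exact lintegral_mono_set (Iic_subset_Iic.2 hab)
  set m := ∫ s, k s with hm
  have hm0 : 0 ≤ m := integral_nonneg hk0
  have hbd : ∀ t, Z t ≤ ENNReal.ofReal ((∫ s, φ s) / (1 - m)) := by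
    intro t
    have h1 := aux_Z1 (fun s => ENNReal.ofReal (k s)) (fun s => ENNReal.ofReal (z s))
      (fun s => ENNReal.ofReal (φ s)) (by fun_prop) (by fun_prop) (by fun_prop)
      (fun t => (aux_ennren k φ z hk0 hki hkneg hφ0 hzm hz0 hzb hren t).2) t
    have h2 : ∫⁻ s, ENNReal.ofReal (k s) * ∫⁻ u in Ici 0, ENNReal.ofReal (z (t - s - u)) ≤
        ENNReal.ofReal m * Z t := by
      rw [hm, ofReal_integral_eq_lintegral_ofReal hki (Eventually.of_forall hk0),
        ← lintegral_mul_const _ (by fun_prop)]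
      refine lintegral_mono fun s => ?_
      by_cases hs : 0 ≤ s
      · exact mul_le_mul_right (hmono (by linarith : t - s ≤ t)) _
      · simp [hkneg s (not_le.1 hs)]
    have h3 : Z t ≤ ENNReal.ofReal (∫ s, φ s) + ENNReal.ofReal m * Z t := by
      calc Z t = _ := h1
        _ ≤ _ := add_le_add (aux_phi_le φ hφ0 hφi t) h2
    rw [← ENNReal.ofReal_toReal (hfin t)] at h3 ⊢
    rw [← ENNReal.ofReal_mul hm0, ← ENNReal.ofReal_add (integral_nonneg hφ0) (by positivity),
      ENNReal.ofReal_le_ofReal_iff (add_nonneg (integral_nonneg hφ0) (by positivity))] at h3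
    refine ENNReal.ofReal_le_ofReal ?_
    rw [le_div_iff₀ (by linarith)]
    linarith
  refine (aecover_Iic (tendsto_id (x := atTop (α := ℝ)))).integrable_of_lintegral_enorm_bounded
    ((∫ s, φ s) / (1 - m)) hzm.aestronglyMeasurable (Eventually.of_forall fun t => ?_)
  refine le_trans (le_of_eq ?_) (hbd t)
  rw [hIic]
  congr 1; ext u
  rw [Real.enorm_of_nonneg (hz0 u)]

/-- Renewal theorem. -/
lemma aux_renewal (k φ z : ℝ → ℝ) (hkm : Measurable k) (hk0 : ∀ s, 0 ≤ k s)
    (K γ : ℝ) (hγ : 0 < γ) (hK : 0 < K) (hkb : ∀ s ≥ 0, |k s| ≤ K * Real.exp (-γ * s))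
    (hkneg : ∀ s < 0, k s = 0) (hk1 : ∫ s, k s = 1)
    (hφm : Measurable φ) (hφ0 : ∀ s, 0 ≤ φ s) (hφi : Integrable φ)
    (Kφ : ℝ) (hφb : ∀ s, |φ s| ≤ Kφ) (hφlim : Tendsto φ atTop (nhds 0)) (hφpos : 0 < ∫ s, φ s)
    (hzm : Measurable z) (hz0 : ∀ s, 0 ≤ z s) (hzneg : ∀ s < 0, z s = 0)
    (hzb : ∀ T : ℝ, ∃ B : ℝ, ∀ t ≤ T, z t ≤ B)
    (hren : ∀ t, z t = φ t + ∫ s, k s * z (t - s)) :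
    ∃ c > 0, (∃ B, ∀ s, |z s| ≤ B) ∧ Tendsto z atTop (nhds c) := by
  have hki : Integrable k := aux_exp_int k hkm K γ hγ hkneg hkb
  have hkK : ∀ s, |k s| ≤ K := aux_exp_bdd k K γ hγ hK.le hkneg hkb
  set κ : ℝ → ℝ := (Ici 0).indicator (fun s => ∫ w in Ioi s, k w) with hκ
  have hκ0 : ∀ s, 0 ≤ κ s := fun s =>
    indicator_nonneg (fun s _ => integral_nonneg hk0) s
  have hanti : Antitone (fun s => ∫ w in Ioi s, k w) := by
    intro a b hab
    exact setIntegral_mono_set hki.integrableOn (Eventually.of_forall hk0)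
      (Ioi_subset_Ioi hab).eventuallyLE
  have hκm : Measurable κ := hanti.measurable.indicator measurableSet_Ici
  have hκneg : ∀ s < 0, κ s = 0 := fun s hs => indicator_of_notMem (not_le.2 hs) _
  have hκb : ∀ s ≥ 0, |κ s| ≤ K / γ * Real.exp (-γ * s) := by
    intro s hs
    rw [abs_of_nonneg (hκ0 s), hκ, indicator_of_mem (show s ∈ Ici 0 from hs)]
    have h1 : ∫ w in Ioi s, k w ≤ ∫ w in Ioi s, K * Real.exp (-γ * w) := by
      refine setIntegral_mono_on hki.integrableOn
        ((integrableOn_exp_mul_Ioi (neg_lt_zero.2 hγ) s).const_mul K) measurableSet_Ioi ?_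
      intro w hw
      exact (le_abs_self _).trans (hkb w (hs.le.trans (le_of_lt hw)))
    rw [integral_const_mul, integral_exp_mul_Ioi (neg_lt_zero.2 hγ)] at h1
    refine h1.trans (le_of_eq ?_)
    field_simp
  have hκi : Integrable κ := aux_exp_int κ hκm (K / γ) γ hγ hκneg hκb
  -- lower bound on κ
  set δ := 1 / (2 * K) with hδdef
  have hδ : 0 < δ := by positivity
  have hκlow : ∀ s, 0 ≤ s → s ≤ δ → 1 / 2 ≤ κ s := by
    intro s hs hsδ
    rw [hκ, indicator_of_mem (show s ∈ Ici 0 from hs)]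
    have h1 := integral_add_compl (s := Ioi s) measurableSet_Ioi hki
    rw [compl_Ioi, hk1] at h1
    have h2 : ∫ w in Iic s, k w = ∫ w in Icc 0 s, k w := by
      refine setIntegral_eq_of_subset_of_forall_sdiff_eq_zero measurableSet_Iic Icc_subset_Iic_self ?_
      intro w hw
      refine hkneg w ?_
      by_contra hcon
      exact hw.2 ⟨not_lt.1 hcon, hw.1⟩
    have h3 := norm_setIntegral_le_of_norm_le_const (f := k) (s := Icc 0 s) (μ := volume) (C := K)
      (by simp) (fun w _ => hkK w)
    rw [Real.volume_real_Icc_of_le hs, Real.norm_eq_abs] at h3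
    have h4 := (abs_le.1 h3).2
    have h5 : K * (s - 0) ≤ 1 / 2 := by
      have : K * s ≤ K * δ := mul_le_mul_of_nonneg_left hsδ hK.le
      have h6 : K * δ = 1 / 2 := by rw [hδdef]; field_simp
      linarith
    linarith
  have hκpos : 0 < ∫ s, κ s := by
    have h1 : ∫ s in Icc 0 δ, (1 / 2 : ℝ) ≤ ∫ s in Icc 0 δ, κ s :=
      setIntegral_mono_on (integrableOn_const (by simp)) hκi.integrableOn measurableSet_Icc
        (fun s hs => hκlow s hs.1 hs.2)
    have h2 := setIntegral_le_integral (s := Icc 0 δ) hκi (Eventually.of_forall hκ0)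
    rw [setIntegral_const, Real.volume_real_Icc_of_le hδ.le, smul_eq_mul] at h1
    have : 0 < (δ - 0) * (1 / 2) := by linarith
    linarith
  -- conservation law
  have hcons : ∀ t, ∫⁻ s, ENNReal.ofReal (κ s) * ENNReal.ofReal (z (t - s)) =
      ∫⁻ u in Ici 0, ENNReal.ofReal (φ (t - u)) := by
    intro t
    have hk1' : ∫⁻ s, ENNReal.ofReal (k s) = 1 := by
      rw [← ofReal_integral_eq_lintegral_ofReal hki (Eventually.of_forall hk0), hk1]; simp
    have h1 := aux_Z1 (fun s => ENNReal.ofReal (k s)) (fun s => ENNReal.ofReal (z s))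
      (fun s => ENNReal.ofReal (φ s)) (by fun_prop) (by fun_prop) (by fun_prop)
      (fun t => (aux_ennren k φ z hk0 hki hkneg hφ0 hzm hz0 hzb hren t).2) t
    have h2 := aux_Z2 (fun s => ENNReal.ofReal (k s)) (fun s => ENNReal.ofReal (z s))
      (by fun_prop) (by fun_prop) (fun s hs => by simp [hkneg s hs]) t
    rw [hk1', one_mul, h1] at h2
    have hfin : ∫⁻ s, ENNReal.ofReal (k s) * ∫⁻ u in Ici 0, ENNReal.ofReal (z (t - s - u)) ≠ ⊤ := by
      refine ne_top_of_le_ne_top (aux_Zfin z hzneg hzb t) ?_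
      rw [h1]; exact le_add_self
    have h3 := (ENNReal.add_left_inj hfin).1 h2
    rw [← h3, ← lintegral_indicator measurableSet_Ici]
    congr 1; ext s
    by_cases hs : 0 ≤ s
    · rw [hκ, indicator_of_mem (show s ∈ Ici 0 from hs), indicator_of_mem (show s ∈ Ici 0 from hs),
        ofReal_integral_eq_lintegral_ofReal hki.integrableOn (Eventually.of_forall hk0)]
    · rw [hκneg s (not_le.1 hs), indicator_of_notMem (show s ∉ Ici 0 from hs)]; simp
  set Γ := ∫ s, φ s with hΓdef
  -- boundedness
  set W : ℝ → ENNReal := fun t => ∫⁻ s in Ici 0, ENNReal.ofReal (Real.exp (-γ * s)) *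
    ENNReal.ofReal (z (t - s)) with hW
  have hwin : ∀ t, ∫⁻ s in Ico 0 δ, ENNReal.ofReal (z (t - s)) ≤ ENNReal.ofReal (2 * Γ) := by
    intro t
    have h1 : ∫⁻ s in Ico 0 δ, ENNReal.ofReal (z (t - s)) ≤
        ∫⁻ s in Ico 0 δ, ENNReal.ofReal 2 * (ENNReal.ofReal (κ s) * ENNReal.ofReal (z (t - s))) := by
      refine setLIntegral_mono' measurableSet_Ico fun s hs => ?_
      rw [← ENNReal.ofReal_mul (hκ0 s), ← ENNReal.ofReal_mul (by norm_num)]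
      refine ENNReal.ofReal_le_ofReal ?_
      have := hκlow s hs.1 hs.2.le
      nlinarith [hz0 (t - s)]
    refine h1.trans ((setLIntegral_le_lintegral _ _).trans ?_)
    rw [lintegral_const_mul _ (by fun_prop), hcons, ENNReal.ofReal_mul (by norm_num)]
    exact mul_le_mul_right (aux_phi_le φ hφ0 hφi t) _
  set ρ := Real.exp (-γ * δ) with hρ
  have hρ1 : ρ < 1 := by
    rw [hρ, ← Real.exp_zero]; exact Real.exp_lt_exp.2 (by nlinarith)
  have hρ0 : 0 < ρ := Real.exp_pos _
  set Q := 2 * Γ / (1 - ρ) with hQ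
  have hQ0 : 0 ≤ Q := div_nonneg (by positivity) (by linarith)
  have hQeq : 2 * Γ + ρ * Q = Q := by
    have : 1 - ρ ≠ 0 := by linarith
    rw [hQ]; field_simp; ring
  have hstep : ∀ t, W t ≤ ENNReal.ofReal (2 * Γ) + ENNReal.ofReal ρ * W (t - δ) := by
    intro t
    have h0 : Ici (0:ℝ) = Ico 0 δ ∪ Ici δ := (Ico_union_Ici_eq_Ici hδ.le).symm
    have h1 : W t ≤ (∫⁻ s in Ico 0 δ, ENNReal.ofReal (Real.exp (-γ * s)) *
        ENNReal.ofReal (z (t - s))) + ∫⁻ s in Ici δ, ENNReal.ofReal (Real.exp (-γ * s)) *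
        ENNReal.ofReal (z (t - s)) := by
      simp only [hW]
      conv_lhs => rw [h0]
      exact lintegral_union_le _ _ _
    refine h1.trans (add_le_add ?_ (le_of_eq ?_))
    · refine le_trans (setLIntegral_mono' measurableSet_Ico fun s hs => ?_) (hwin t)
      rw [← ENNReal.ofReal_mul (Real.exp_pos _).le]
      refine ENNReal.ofReal_le_ofReal ?_
      have : Real.exp (-γ * s) ≤ 1 := Real.exp_le_one_iff.2 (by nlinarith [hs.1])
      nlinarith [hz0 (t - s)]
    · simp only [hW]
      rw [← lintegral_const_mul _ (by fun_prop), ← lintegral_indicator measurableSet_Ici,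
        ← lintegral_indicator measurableSet_Ici, ← lintegral_add_right_eq_self _ δ]
      congr 1; ext u
      by_cases hu : 0 ≤ u
      · rw [indicator_of_mem (show u ∈ Ici 0 from hu),
          indicator_of_mem (show u + δ ∈ Ici δ by simpa using hu), ← mul_assoc,
          ← ENNReal.ofReal_mul hρ0.le, hρ, ← Real.exp_add]
        congr 3 <;> ring
      · rw [indicator_of_notMem (show u ∉ Ici 0 from hu),
          indicator_of_notMem (show u + δ ∉ Ici δ by simpa using hu)]
  have hWb : ∀ n : ℕ, ∀ t, t < n * δ → W t ≤ ENNReal.ofReal Q := by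
    intro n
    induction n with
    | zero =>
      intro t ht
      simp only [Nat.cast_zero, zero_mul] at ht
      have : W t = 0 := by
        simp only [hW]
        rw [setLIntegral_congr_fun (g := fun _ => 0) measurableSet_Ici]
        · simp
        · intro s hs
          have : t - s < 0 := by linarith [show (0:ℝ) ≤ s from hs]
          simp [hzneg _ this]
      rw [this]; exact zero_le
    | succ n ih =>
      intro t ht
      push_cast at ht
      refine (hstep t).trans ?_
      refine (add_le_add le_rfl (mul_le_mul_right (ih (t - δ) (by linarith)) _)).trans ?_
      rw [← ENNReal.ofReal_mul hρ0.le, ← ENNReal.ofReal_add (by positivity) (by positivity), hQeq]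
  have hWb' : ∀ t, W t ≤ ENNReal.ofReal Q := by
    intro t
    obtain ⟨n, hn⟩ := exists_nat_gt (t / δ)
    rw [div_lt_iff₀ hδ] at hn
    exact hWb n t hn
  set v : ℝ → ℝ := fun t => ∫ s, k s * z (t - s) with hv
  have hvb : ∀ t, v t ≤ K * Q := by
    intro t
    have hi := (aux_ennren k φ z hk0 hki hkneg hφ0 hzm hz0 hzb hren t).1
    rw [← ENNReal.ofReal_le_ofReal_iff (by positivity), hv, ofReal_integral_eq_lintegral_ofReal hi
      (Eventually.of_forall fun s => mul_nonneg (hk0 s) (hz0 _)), ENNReal.ofReal_mul hK.le]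
    refine le_trans ?_ (mul_le_mul_right (hWb' t) _)
    simp only [hW]
    rw [← lintegral_const_mul _ (by fun_prop), ← lintegral_indicator measurableSet_Ici]
    refine lintegral_mono fun s => ?_
    by_cases hs : 0 ≤ s
    · rw [indicator_of_mem (show s ∈ Ici 0 from hs), ← mul_assoc, ← ENNReal.ofReal_mul hK.le,
        ← ENNReal.ofReal_mul (by positivity)]
      refine ENNReal.ofReal_le_ofReal (mul_le_mul_of_nonneg_right ?_ (hz0 _))
      exact (le_abs_self _).trans (hkb s hs)
    · rw [hkneg s (not_le.1 hs)]; simp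
  have hv0 : ∀ t, 0 ≤ v t := fun t => integral_nonneg fun s => mul_nonneg (hk0 s) (hz0 _)
  have hzv : ∀ t, v t = z t - φ t := fun t => by rw [hren t]; simp [hv]
  have hzB : ∀ t, |z t| ≤ Kφ + K * Q := by
    intro t
    rw [abs_of_nonneg (hz0 t)]
    have h1 := hvb t
    rw [hzv] at h1
    have h2 := (le_abs_self _).trans (hφb t)
    linarith
  have huc : UniformContinuous v := aux_conv_uc k z hki hzm _ hzB
  have hvm : Measurable v := huc.continuous.measurable
  have hshm : ∀ (f : ℝ → ℝ) (t : ℝ), Measurable f → Measurable fun s => f (t - s) := fun f t hf =>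
    hf.comp (measurable_const.sub measurable_id)
  have hconvsub : ∀ p : ℝ → ℝ, Integrable p → ∀ t, ∫ s, p s * v (t - s) =
      (∫ s, p s * z (t - s)) - ∫ s, p s * φ (t - s) := by
    intro p hp t
    rw [← integral_sub (aux_int_mul p _ hp (hshm z t hzm) _ (fun s => hzB _))
      (aux_int_mul p _ hp (hshm φ t hφm) _ (fun s => hφb _))]
    congr 1; ext s
    rw [hzv]; ring
  have hharm : Tendsto (fun t => v t - ∫ s, k s * v (t - s)) atTop (nhds 0) := by
    have h1 := aux_conv_tendsto k φ hki hφm Kφ 0 hφb hφlim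
    rw [zero_mul] at h1
    refine h1.congr fun t => ?_
    rw [hconvsub k hki]
    simp [hv]
  have hΦ : ∀ t, ∫ s, κ s * z (t - s) = ∫ u in Iic t, φ u := by
    intro t
    have hmm := hshm z t hzm
    have e1 : ∫ u in Iic t, φ u = ∫ u in Ici 0, φ (t - u) := by
      rw [← integral_indicator measurableSet_Ici, ← integral_indicator measurableSet_Iic,
        ← integral_sub_left_eq_self _ volume t]
      congr 1; ext u
      by_cases hu : 0 ≤ u
      · rw [indicator_of_mem (show u ∈ Ici 0 from hu),
          indicator_of_mem (show t - u ∈ Iic t by simpa using hu)]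
      · rw [indicator_of_notMem (show u ∉ Ici 0 from hu),
          indicator_of_notMem (show t - u ∉ Iic t by simpa using hu)]
    rw [e1, integral_eq_lintegral_of_nonneg_ae (Eventually.of_forall fun u => hφ0 _)
      (hshm φ t hφm).aestronglyMeasurable, ← hcons, integral_eq_lintegral_of_nonneg_ae
      (Eventually.of_forall fun s => mul_nonneg (hκ0 s) (hz0 _))
      (hκm.mul hmm).aestronglyMeasurable]
    congr 2; ext s
    rw [ENNReal.ofReal_mul (hκ0 s)]
  have hΓ : Tendsto (fun t => ∫ s, κ s * v (t - s)) atTop (nhds Γ) := by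
    have h1 := aux_conv_tendsto κ φ hκi hφm Kφ 0 hφb hφlim
    rw [zero_mul] at h1
    have h2 : Tendsto (fun t => ∫ s, κ s * z (t - s)) atTop (nhds Γ) := by
      simp_rw [hΦ]
      exact (aecover_Iic (tendsto_id (x := atTop (α := ℝ)))).integral_tendsto_of_countably_generated
        hφi
    have h3 := h2.sub h1
    rw [sub_zero] at h3
    refine h3.congr fun t => ?_
    rw [hconvsub κ hκi]
  have hlim := aux_limit k κ v hkm hk0 hki hkneg hk1 hκ0 hκi hκneg hκpos hvm huc (K * Q)
    (fun s => by rw [abs_of_nonneg (hv0 s)]; exact hvb s) hharm Γ hΓ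
  refine ⟨Γ / ∫ s, κ s, div_pos hφpos hκpos, ⟨_, hzB⟩, ?_⟩
  have := hlim.add hφlim
  rw [add_zero] at this
  refine this.congr fun t => ?_
  rw [hzv]; ring


lemma aux_conv_interval (p y : ℝ → ℝ) (t : ℝ) :
    (0 ≤ t → ∫ s, (Ici 0).indicator p s * (Ici 0).indicator y (t - s) =
      ∫ s in (0:ℝ)..t, p (t - s) * y s) ∧
    (t < 0 → ∫ s, (Ici 0).indicator p s * (Ici 0).indicator y (t - s) = 0) := by
  constructor
  · intro ht
    rw [← integral_sub_left_eq_self _ volume t, intervalIntegral.integral_of_le ht,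
      ← integral_Icc_eq_integral_Ioc, ← integral_indicator measurableSet_Icc]
    congr 1; ext s
    simp only [sub_sub_cancel]
    by_cases h1 : 0 ≤ s
    · by_cases h2 : s ≤ t
      · rw [indicator_of_mem (show t - s ∈ Ici 0 by simpa using h2),
          indicator_of_mem (show s ∈ Ici 0 from h1), indicator_of_mem (show s ∈ Icc 0 t from ⟨h1, h2⟩)]
      · rw [indicator_of_notMem (show t - s ∉ Ici 0 by simpa using h2),
          indicator_of_notMem (show s ∉ Icc 0 t from fun h => h2 h.2), zero_mul]
    · rw [indicator_of_notMem (show s ∉ Ici 0 from h1),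
          indicator_of_notMem (show s ∉ Icc 0 t from fun h => h1 h.1), mul_zero]
  · intro ht
    refine (integral_congr_ae (Eventually.of_forall fun s => ?_)).trans (integral_zero ℝ ℝ)
    by_cases h1 : 0 ≤ s
    · rw [indicator_of_notMem (show t - s ∉ Ici 0 by simp only [mem_Ici, not_le]; linarith), mul_zero]
    · rw [indicator_of_notMem (show s ∉ Ici 0 from h1), zero_mul]

lemma aux_G_bound (α : ℝ) (ν : MeasureTheory.SignedMeasure ℝ) (ψ : ℝ → ℝ) (C γ : ℝ)
    (hC : 0 ≤ C) (hγ : 0 < γ) (hb : ∀ v ≥ -α, |ψ v| ≤ C * Real.exp (-γ * v)) :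
    ∃ K > 0, ∀ t ≥ 0, |Gν α ν ψ t| ≤ K * Real.exp (-γ * t) := by
  have hone : ∀ (p : Measure ℝ) [IsFiniteMeasure p], ∀ t ≥ 0,
      |∫ u in Icc (-α) 0, ψ (t + u) ∂p| ≤
        C * Real.exp (γ * α) * Real.exp (-γ * t) * p.real (Icc (-α) 0) := by
    intro p _ t ht
    rw [← Real.norm_eq_abs]
    refine norm_setIntegral_le_of_norm_le_const (measure_lt_top _ _) fun u hu => ?_
    refine (hb (t + u) (by linarith [hu.1])).trans ?_
    rw [mul_assoc, ← Real.exp_add]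
    refine mul_le_mul_of_nonneg_left (Real.exp_le_exp.2 ?_) hC
    nlinarith [hu.1]
  refine ⟨C * Real.exp (γ * α) * (ν.toJordanDecomposition.posPart.real (Icc (-α) 0) +
    ν.toJordanDecomposition.negPart.real (Icc (-α) 0)) + 1, by positivity, fun t ht => ?_⟩
  have h1 := hone ν.toJordanDecomposition.posPart t ht
  have h2 := hone ν.toJordanDecomposition.negPart t ht
  have h3 := abs_sub (∫ u in Icc (-α) 0, ψ (t + u) ∂ν.toJordanDecomposition.posPart)
    (∫ u in Icc (-α) 0, ψ (t + u) ∂ν.toJordanDecomposition.negPart)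
  unfold Gν
  have := Real.exp_pos (-γ * t)
  nlinarith

lemma aux_G_sq_bound (G K γ t : ℝ) (h : |G| ≤ K * Real.exp (-γ * t)) :
    |G ^ 2| ≤ K ^ 2 * Real.exp (-(2 * γ) * t) := by
  have h1 : Real.exp (-(2 * γ) * t) = Real.exp (-γ * t) ^ 2 := by
    rw [← Real.exp_nat_mul]; congr 1; push_cast; ring
  rw [h1, ← mul_pow, abs_pow]
  exact pow_le_pow_left₀ (abs_nonneg _) h 2

lemma aux_G_meas (α : ℝ) (ν : MeasureTheory.SignedMeasure ℝ) (ψ : ℝ → ℝ) (h : Measurable ψ) :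
    Measurable (Gν α ν ψ) := by
  have hone : ∀ (p : Measure ℝ) [IsFiniteMeasure p],
      Measurable (fun t => ∫ u in Icc (-α) 0, ψ (t + u) ∂p) := by
    intro p _
    have : StronglyMeasurable (Function.uncurry fun t u : ℝ => ψ (t + u)) :=
      (h.comp (measurable_fst.add measurable_snd)).stronglyMeasurable
    exact (this.integral_prod_right).measurable
  exact (hone _).sub (hone _)

lemma aux_G_cont (α : ℝ) (ν : MeasureTheory.SignedMeasure ℝ) (ψ : ℝ → ℝ) (h : Continuous ψ) :
    Continuous (Gν α ν ψ) := by
  have hone : ∀ (p : Measure ℝ) [IsFiniteMeasure p],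
      Continuous (fun t => ∫ u in Icc (-α) 0, ψ (t + u) ∂p) := by
    intro p _
    exact continuous_parametric_integral_of_continuous (f := fun t u : ℝ => ψ (t + u))
      (by fun_prop) isCompact_Icc
  exact (hone _).sub (hone _)

lemma aux_G_zero (α : ℝ) (ν : MeasureTheory.SignedMeasure ℝ) (ψ : ℝ → ℝ) (h : Measurable ψ)
    (h0 : ∀ᵐ s, ψ s = 0) : ∀ᵐ t, Gν α ν ψ t = 0 := by
  have hone : ∀ (p : Measure ℝ) [IsFiniteMeasure p],
      ∀ᵐ t, ∫ u in Icc (-α) 0, ψ (t + u) ∂p = 0 := by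
    intro p _
    have h1 : ∀ᵐ u ∂(p.restrict (Icc (-α) 0)), ∀ᵐ t, ψ (t + u) = 0 :=
      Eventually.of_forall fun u => (measurePreserving_add_right volume u).quasiMeasurePreserving.ae h0
    have h2 : ∀ᵐ t, ∀ᵐ u ∂(p.restrict (Icc (-α) 0)), ψ (t + u) = 0 := by
      refine (Measure.ae_ae_comm ?_).1 h1
      have : Measurable fun q : ℝ × ℝ => ψ (q.2 + q.1) :=
        h.comp (measurable_snd.add measurable_fst)
      exact this (measurableSet_singleton 0)
    filter_upwards [h2] with t ht
    exact integral_eq_zero_of_ae ht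
  filter_upwards [hone ν.toJordanDecomposition.posPart, hone ν.toJordanDecomposition.negPart]
    with t h1 h2
  simp [Gν, h1, h2]

lemma aux_critical (k φ z : ℝ → ℝ) (hkm : Measurable k) (hk0 : ∀ s, 0 ≤ k s)
    (K γ : ℝ) (hγ : 0 < γ) (hK : 0 < K) (hkb : ∀ s ≥ 0, |k s| ≤ K * Real.exp (-γ * s))
    (hkneg : ∀ s < 0, k s = 0) (β : ℝ) (hβ : 0 ≤ β)
    (hk1 : ∫ s, Real.exp (-β * s) * k s = 1)
    (hφm : Measurable φ) (hφ0 : ∀ s, 0 ≤ φ s) (hφi : Integrable φ) (hφneg : ∀ s < 0, φ s = 0)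
    (Kφ : ℝ) (hKφ : 0 ≤ Kφ) (hφb : ∀ s ≥ 0, |φ s| ≤ Kφ * Real.exp (-γ * s)) (hφpos : 0 < ∫ s, φ s)
    (hzm : Measurable z) (hz0 : ∀ s, 0 ≤ z s) (hzneg : ∀ s < 0, z s = 0)
    (hzb : ∀ T : ℝ, ∃ B : ℝ, ∀ t ≤ T, z t ≤ B)
    (hren : ∀ t, z t = φ t + ∫ s, k s * z (t - s)) :
    ∃ c > 0, (∃ B, ∀ s, |Real.exp (-β * s) * z s| ≤ B) ∧
      Tendsto (fun s => Real.exp (-β * s) * z s) atTop (nhds c) := by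
  have hexp : ∀ (f : ℝ → ℝ) (D : ℝ), (∀ s ≥ 0, |f s| ≤ D * Real.exp (-γ * s)) →
      ∀ s ≥ 0, |Real.exp (-β * s) * f s| ≤ D * Real.exp (-γ * s) := by
    intro f D hf s hs
    rw [abs_mul, abs_of_pos (Real.exp_pos _)]
    have : Real.exp (-β * s) ≤ 1 := Real.exp_le_one_iff.2 (by nlinarith)
    exact (mul_le_of_le_one_left (abs_nonneg _) this).trans (hf s hs)
  have hφm' : Measurable fun s => Real.exp (-β * s) * φ s := by fun_prop
  have hφb' := hexp φ Kφ hφb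
  have hφneg' : ∀ s < 0, Real.exp (-β * s) * φ s = 0 := fun s hs => by simp [hφneg s hs]
  have hφi' := aux_exp_int _ hφm' Kφ γ hγ hφneg' hφb'
  refine aux_renewal (fun s => Real.exp (-β * s) * k s) (fun s => Real.exp (-β * s) * φ s)
    (fun s => Real.exp (-β * s) * z s) (by fun_prop)
    (fun s => mul_nonneg (Real.exp_pos _).le (hk0 s)) K γ hγ hK (hexp k K hkb)
    (fun s hs => by simp [hkneg s hs]) hk1 hφm'
    (fun s => mul_nonneg (Real.exp_pos _).le (hφ0 s)) hφi' Kφ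
    (aux_exp_bdd _ Kφ γ hγ hKφ hφneg' hφb')
    (aux_exp_lim _ Kφ γ hγ hφb') ?_ (by fun_prop)
    (fun s => mul_nonneg (Real.exp_pos _).le (hz0 s)) (fun s hs => by simp [hzneg s hs]) ?_ ?_
  · rw [integral_pos_iff_support_of_nonneg (fun s => mul_nonneg (Real.exp_pos _).le (hφ0 s)) hφi']
    rw [integral_pos_iff_support_of_nonneg hφ0 hφi] at hφpos
    convert hφpos using 2
    ext s; simp
  · intro T
    obtain ⟨B, hB⟩ := hzb T
    refine ⟨max B 0, fun t ht => ?_⟩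
    by_cases h : 0 ≤ t
    · have : Real.exp (-β * t) ≤ 1 := Real.exp_le_one_iff.2 (by nlinarith)
      exact (mul_le_of_le_one_left (hz0 t) this).trans ((hB t ht).trans (le_max_left _ _))
    · simp [hzneg t (not_le.1 h)]
  · intro t
    rw [hren t, mul_add, ← integral_const_mul]
    congr 2; ext s
    have : Real.exp (-β * t) = Real.exp (-β * s) * Real.exp (-β * (t - s)) := by
      rw [← Real.exp_add]; congr 1; ring
    rw [this]; ring

lemma aux_malthus (k : ℝ → ℝ) (hkm : Measurable k) (hk0 : ∀ s, 0 ≤ k s)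
    (K γ : ℝ) (hγ : 0 < γ) (hK : 0 < K) (hkb : ∀ s ≥ 0, |k s| ≤ K * Real.exp (-γ * s))
    (hkneg : ∀ s < 0, k s = 0) (hk1 : 1 < ∫ s, k s) :
    ∃ β > 0, ∫ s, Real.exp (-β * s) * k s = 1 := by
  have hki := aux_exp_int k hkm K γ hγ hkneg hkb
  set H : ℝ → ℝ := fun β => ∫ s, Real.exp (-β * s) * k s with hH
  have hH0 : H 0 = ∫ s, k s := by simp [hH]
  have hle : ∀ β ≥ 0, ∀ s, ‖Real.exp (-β * s) * k s‖ ≤ |k s| := by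
    intro β hβ s
    rw [norm_mul, Real.norm_of_nonneg (Real.exp_pos _).le, Real.norm_eq_abs]
    by_cases hs : 0 ≤ s
    · have : Real.exp (-β * s) ≤ 1 := Real.exp_le_one_iff.2 (by nlinarith)
      exact mul_le_of_le_one_left (abs_nonneg _) this
    · simp [hkneg s (not_le.1 hs)]
  have hcont : ContinuousOn H (Icc 0 K) := by
    refine continuousOn_of_dominated (bound := fun s => |k s|) ?_ ?_ hki.abs ?_
    · intro β _
      exact (by fun_prop : Measurable fun s => Real.exp (-β * s) * k s).aestronglyMeasurable
    · intro β hβ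
      exact Eventually.of_forall (hle β hβ.1)
    · exact Eventually.of_forall fun s => by fun_prop
  have hK1 : H K < 1 := by
    have hi : Integrable fun s => Real.exp (-K * s) * k s :=
      hki.abs.mono' (by fun_prop : Measurable fun s => Real.exp (-K * s) * k s).aestronglyMeasurable
        (Eventually.of_forall (hle K hK.le))
    have hneg : -(K + γ) < 0 := by linarith
    have h1 : H K = ∫ s in Ioi 0, Real.exp (-K * s) * k s := by
      rw [← integral_Ici_eq_integral_Ioi]
      symm
      refine setIntegral_eq_integral_of_forall_compl_eq_zero fun s hs => ?_
      simp [hkneg s (not_le.1 hs)]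
    have h2 : ∫ s in Ioi 0, Real.exp (-K * s) * k s ≤
        ∫ s in Ioi 0, K * Real.exp (-(K + γ) * s) := by
      refine setIntegral_mono_on hi.integrableOn
        ((integrableOn_exp_mul_Ioi hneg 0).const_mul K) measurableSet_Ioi ?_
      intro s hs
      have e : Real.exp (-(K + γ) * s) = Real.exp (-K * s) * Real.exp (-γ * s) := by
        rw [← Real.exp_add]; congr 1; ring
      have := (le_abs_self _).trans (hkb s (le_of_lt hs))
      rw [e]
      nlinarith [Real.exp_pos (-K * s)]
    rw [integral_const_mul, integral_exp_mul_Ioi hneg] at h2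
    rw [h1]
    refine h2.trans_lt ?_
    simp only [mul_zero, Real.exp_zero, neg_div_neg_eq]
    rw [mul_one_div, div_lt_one (by positivity)]
    linarith
  obtain ⟨β, hβ, hβ1⟩ := intermediate_value_Icc' hK.le hcont
    (show (1:ℝ) ∈ Icc (H K) (H 0) from ⟨hK1.le, by rw [hH0]; exact hk1.le⟩)
  refine ⟨β, lt_of_le_of_ne hβ.1 ?_, hβ1⟩
  rintro rfl
  rw [hH0] at hβ1
  linarith

/-- Deterministic core of Corollary 3.3: mean-square trichotomy. -/
theorem stmt9 (α : ℝ) (hα : 0 ≤ α) (ν : MeasureTheory.SignedMeasure ℝ)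
    (C γ : ℝ) (hC : 0 < C) (hγ : 0 < γ)
    (r : ℝ → ℝ) (hrmeas : Measurable r) (hrneg : ∀ u < (0:ℝ), r u = 0)
    (hrdecay : ∀ t ≥ (0:ℝ), |r t| ≤ C * Real.exp (-γ * t))
    (x : ℝ → ℝ) (hxcont : Continuous x)
    (hxdecay : ∀ t ≥ (0:ℝ), |x t| ≤ C * Real.exp (-γ * t))
    (f g : ℝ → ℝ)
    (hf : ∀ t ≥ (0:ℝ), f t = (Gν α ν x t) ^ 2)
    (hg : ∀ t ≥ (0:ℝ), g t = (Gν α ν r t) ^ 2)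
    (y : ℝ → ℝ) (hymeas : Measurable y) (hynn : ∀ t ≥ (0:ℝ), 0 ≤ y t)
    (hybdd : ∀ T : ℝ, ∃ K : ℝ, ∀ t ∈ Set.Icc (0:ℝ) T, y t ≤ K)
    (hren : ∀ t ≥ (0:ℝ), y t = f t + ∫ s in (0:ℝ)..t, g (t - s) * y s)
    (M : ℝ → ℝ)
    (hM : ∀ t ≥ (0:ℝ), M t = (x t) ^ 2 + ∫ s in (0:ℝ)..t, (r (t - s)) ^ 2 * y s)
    (hnondeg : ∃ t ≥ (0:ℝ), Gν α ν x t ≠ 0) :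
    (Tendsto M atTop (nhds 0) ↔ (∫ s in Set.Ioi (0:ℝ), g s) < 1) ∧
    ((∃ c : ℝ, 0 < c ∧ Tendsto M atTop (nhds c)) ↔ (∫ s in Set.Ioi (0:ℝ), g s) = 1) ∧
    (Tendsto M atTop atTop ↔ 1 < (∫ s in Set.Ioi (0:ℝ), g s)) := by
  have hγ2 : 0 < 2 * γ := by linarith
  -- bounds for `G r` and `G x`
  obtain ⟨Kr, hKr, hGr⟩ := aux_G_bound α ν r C γ hC.le hγ (by
    intro v _
    by_cases hv : 0 ≤ v
    · exact hrdecay v hv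
    · rw [hrneg v (not_le.1 hv)]; simp; positivity)
  obtain ⟨Kx, hKx, hGx⟩ : ∃ K > 0, ∀ t ≥ 0, |Gν α ν x t| ≤ K * Real.exp (-γ * t) := by
    obtain ⟨m, hm⟩ := (isCompact_Icc (a := -α) (b := (0:ℝ))).exists_bound_of_continuousOn
      hxcont.continuousOn
    refine aux_G_bound α ν x (max C m) γ (hC.le.trans (le_max_left _ _)) hγ ?_
    intro v hv
    by_cases hv0 : 0 ≤ v
    · exact (hxdecay v hv0).trans
        (mul_le_mul_of_nonneg_right (le_max_left _ _) (Real.exp_pos _).le)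
    · rw [not_le] at hv0
      have h1 := hm v ⟨hv, hv0.le⟩
      rw [Real.norm_eq_abs] at h1
      have h2 : 1 ≤ Real.exp (-γ * v) := Real.one_le_exp (by nlinarith)
      have h3 : m ≤ max C m := le_max_right _ _
      have h4 : 0 ≤ max C m := hC.le.trans (le_max_left _ _)
      nlinarith
  -- extended functions
  set k : ℝ → ℝ := (Ici 0).indicator (fun t => (Gν α ν r t) ^ 2) with hk
  set φ : ℝ → ℝ := (Ici 0).indicator (fun t => (Gν α ν x t) ^ 2) with hφ
  set z : ℝ → ℝ := (Ici 0).indicator y with hz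
  set R : ℝ → ℝ := (Ici 0).indicator (fun t => (r t) ^ 2) with hR
  have hneg : ∀ (p : ℝ → ℝ), ∀ s < 0, (Ici (0:ℝ)).indicator p s = 0 := fun p s hs =>
    indicator_of_notMem (not_le.2 hs) _
  have hpos : ∀ (p : ℝ → ℝ), ∀ s ≥ 0, (Ici (0:ℝ)).indicator p s = p s := fun p s hs =>
    indicator_of_mem hs _
  have hkm : Measurable k := ((aux_G_meas α ν r hrmeas).pow_const 2).indicator measurableSet_Ici
  have hφm : Measurable φ :=
    ((aux_G_meas α ν x hxcont.measurable).pow_const 2).indicator measurableSet_Ici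
  have hzm : Measurable z := hymeas.indicator measurableSet_Ici
  have hRm : Measurable R := (hrmeas.pow_const 2).indicator measurableSet_Ici
  have hk0 : ∀ s, 0 ≤ k s := fun s => indicator_nonneg (fun _ _ => sq_nonneg _) s
  have hφ0 : ∀ s, 0 ≤ φ s := fun s => indicator_nonneg (fun _ _ => sq_nonneg _) s
  have hR0 : ∀ s, 0 ≤ R s := fun s => indicator_nonneg (fun _ _ => sq_nonneg _) s
  have hz0 : ∀ s, 0 ≤ z s := fun s => indicator_nonneg (fun t ht => hynn t ht) s
  have hkb : ∀ s ≥ 0, |k s| ≤ Kr ^ 2 * Real.exp (-(2 * γ) * s) := fun s hs => by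
    rw [hk, hpos _ s hs]; exact aux_G_sq_bound _ _ _ _ (hGr s hs)
  have hφb : ∀ s ≥ 0, |φ s| ≤ Kx ^ 2 * Real.exp (-(2 * γ) * s) := fun s hs => by
    rw [hφ, hpos _ s hs]; exact aux_G_sq_bound _ _ _ _ (hGx s hs)
  have hRb : ∀ s ≥ 0, |R s| ≤ C ^ 2 * Real.exp (-(2 * γ) * s) := fun s hs => by
    rw [hR, hpos _ s hs]; exact aux_G_sq_bound _ _ _ _ (hrdecay s hs)
  have hki := aux_exp_int k hkm _ _ hγ2 (hneg _) hkb
  have hφi := aux_exp_int φ hφm _ _ hγ2 (hneg _) hφb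
  have hRi := aux_exp_int R hRm _ _ hγ2 (hneg _) hRb
  have hzb : ∀ T : ℝ, ∃ B : ℝ, ∀ t ≤ T, z t ≤ B := by
    intro T
    obtain ⟨B, hB⟩ := hybdd T
    refine ⟨max B 0, fun t ht => ?_⟩
    by_cases h : 0 ≤ t
    · rw [hz, hpos _ t h]; exact (hB t ⟨h, ht⟩).trans (le_max_left _ _)
    · rw [hz, hneg _ t (not_le.1 h)]; exact le_max_right _ _
  have hren' : ∀ t, z t = φ t + ∫ s, k s * z (t - s) := by
    intro t
    by_cases ht : 0 ≤ t
    · rw [hz, hφ, hk, (aux_conv_interval _ _ t).1 ht, hpos _ t ht, hpos _ t ht, hren t ht, hf t ht]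
      congr 1
      refine intervalIntegral.integral_congr fun s hs => ?_
      rw [uIcc_of_le ht] at hs
      rw [hg (t - s) (by linarith [hs.2])]
    · rw [not_le] at ht
      rw [hz, hφ, hk, (aux_conv_interval _ _ t).2 ht, hneg _ t ht, hneg _ t ht, add_zero]
  have hM' : ∀ t ≥ 0, M t = (x t) ^ 2 + ∫ s, R s * z (t - s) := by
    intro t ht
    rw [hM t ht, hR, hz, (aux_conv_interval _ _ t).1 ht]
  have hgk : ∫ s in Ioi (0:ℝ), g s = ∫ s, k s := by
    rw [hk, integral_indicator measurableSet_Ici, integral_Ici_eq_integral_Ioi]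
    exact setIntegral_congr_fun measurableSet_Ioi fun s hs => hg s (le_of_lt hs)
  have hφpos : 0 < ∫ s, φ s := by
    obtain ⟨t0, ht0, hne⟩ := hnondeg
    have hc := aux_G_cont α ν x hxcont
    rw [integral_pos_iff_support_of_nonneg hφ0 hφi]
    have hopen : IsOpen {t | Gν α ν x t ≠ 0} := isOpen_ne_fun hc continuous_const
    obtain ⟨ε, hε, hball⟩ := Metric.isOpen_iff.1 hopen t0 hne
    have hsub : Ioo t0 (t0 + ε) ⊆ Function.support φ := by
      intro s hs
      have hs0 : 0 ≤ s := by linarith [hs.1]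
      have h1 : s ∈ Metric.ball t0 ε := by
        rw [Metric.mem_ball, Real.dist_eq, abs_lt]
        constructor <;> linarith [hs.1, hs.2]
      rw [Function.mem_support, hφ, hpos _ s hs0]
      exact pow_ne_zero 2 (hball h1)
    refine lt_of_lt_of_le ?_ (measure_mono hsub)
    simp [hε]
  have hx2 : Tendsto (fun t => (x t) ^ 2) atTop (nhds 0) := by
    simpa using (aux_exp_lim x C γ hγ hxdecay).pow 2
  have hRpos : 0 < ∫ s, k s → ∀ β, 0 ≤ β → Integrable (fun s => Real.exp (-β * s) * R s) ∧
      0 < ∫ s, Real.exp (-β * s) * R s := by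
    intro hkpos β hβ
    have hi : Integrable (fun s => Real.exp (-β * s) * R s) := by
      refine hRi.mono' (by fun_prop) (Eventually.of_forall fun s => ?_)
      rw [Real.norm_of_nonneg (mul_nonneg (Real.exp_pos _).le (hR0 s))]
      by_cases hs : 0 ≤ s
      · exact mul_le_of_le_one_left (hR0 s) (Real.exp_le_one_iff.2 (by nlinarith))
      · rw [hR, hneg _ s (not_le.1 hs)]; simp
    refine ⟨hi, ?_⟩
    rw [integral_pos_iff_support_of_nonneg (fun s => mul_nonneg (Real.exp_pos _).le (hR0 s)) hi,
      pos_iff_ne_zero]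
    intro hzero
    have hr0 : ∀ᵐ s, r s = 0 := by
      have : ∀ᵐ s, s ∉ Function.support fun s => Real.exp (-β * s) * R s :=
        measure_eq_zero_iff_ae_notMem.1 hzero
      filter_upwards [this] with s hs
      by_cases h : 0 ≤ s
      · simpa [hR, hpos _ s h, h] using hs
      · exact hrneg s (not_le.1 h)
    have hG0 := aux_G_zero α ν r hrmeas hr0
    have : ∫ s, k s = 0 := by
      refine integral_eq_zero_of_ae ?_
      filter_upwards [hG0] with s hs
      simp [hk, indicator, hs]
    linarith
  -- three implications
  have case1 : ∫ s, k s < 1 → Tendsto M atTop (nhds 0) := by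
    intro hlt
    have hzi := aux_sub k φ z hkm hk0 hki (hneg _) hlt hφm hφ0 hφi hzm hz0 (hneg _) hzb hren'
    have h1 := aux_conv_tendsto z R hzi hRm (C ^ 2) 0
      (aux_exp_bdd R _ _ hγ2 (by positivity) (hneg _) hRb) (aux_exp_lim R _ _ hγ2 hRb)
    rw [zero_mul] at h1
    have h2 := hx2.add h1
    rw [add_zero] at h2
    refine h2.congr' ?_
    filter_upwards [eventually_ge_atTop 0] with t ht
    rw [hM' t ht, ← integral_sub_left_eq_self (fun s => R s * z (t - s)) volume t]
    congr 2; ext s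
    rw [sub_sub_cancel, mul_comm]
  have case2 : ∫ s, k s = 1 → ∃ c : ℝ, 0 < c ∧ Tendsto M atTop (nhds c) := by
    intro heq
    obtain ⟨c, hc, ⟨B, hB⟩, hlim⟩ := aux_critical k φ z hkm hk0 (Kr ^ 2) (2 * γ) hγ2 (by positivity)
      hkb (hneg _) 0 le_rfl (by simpa using heq) hφm hφ0 hφi (hneg _) (Kx ^ 2) (by positivity) hφb
      hφpos hzm hz0 (hneg _) hzb hren'
    simp only [neg_zero, zero_mul, Real.exp_zero, one_mul] at hB hlim
    have hRp := (hRpos (by linarith) 0 le_rfl).2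
    simp only [neg_zero, zero_mul, Real.exp_zero, one_mul] at hRp
    refine ⟨c * ∫ s, R s, mul_pos hc hRp, ?_⟩
    have h2 := hx2.add (aux_conv_tendsto R z hRi hzm B c hB hlim)
    rw [zero_add] at h2
    refine h2.congr' ?_
    filter_upwards [eventually_ge_atTop 0] with t ht
    rw [hM' t ht]
  have case3 : 1 < ∫ s, k s → Tendsto M atTop atTop := by
    intro hgt
    obtain ⟨β, hβ, hβ1⟩ := aux_malthus k hkm hk0 (Kr ^ 2) (2 * γ) hγ2 (by positivity)
      hkb (hneg _) hgt
    obtain ⟨c, hc, ⟨B, hB⟩, hlim⟩ := aux_critical k φ z hkm hk0 (Kr ^ 2) (2 * γ) hγ2 (by positivity)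
      hkb (hneg _) β hβ.le hβ1 hφm hφ0 hφi (hneg _) (Kx ^ 2) (by positivity) hφb
      hφpos hzm hz0 (hneg _) hzb hren'
    obtain ⟨hRi', hRp⟩ := hRpos (by linarith) β hβ.le
    have h1 := aux_conv_tendsto _ _ hRi' (by fun_prop) B c hB hlim
    have h2 : Tendsto (fun t : ℝ => Real.exp (β * t)) atTop atTop :=
      Real.tendsto_exp_atTop.comp (tendsto_id.const_mul_atTop hβ)
    have h3 := h2.atTop_mul_pos (mul_pos hc hRp) h1
    refine tendsto_atTop_mono' _ ?_ h3
    filter_upwards [eventually_ge_atTop 0] with t ht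
    rw [hM' t ht, ← integral_const_mul]
    have h4 : ∫ s, Real.exp (β * t) * (Real.exp (-β * s) * R s *
        (Real.exp (-β * (t - s)) * z (t - s))) = ∫ s, R s * z (t - s) := by
      congr 1; ext s
      have e : Real.exp (β * t) * Real.exp (-β * s) * Real.exp (-β * (t - s)) = 1 := by
        rw [← Real.exp_add, ← Real.exp_add, ← Real.exp_zero]; congr 1; ring
      calc _ = (Real.exp (β * t) * Real.exp (-β * s) * Real.exp (-β * (t - s))) *
            (R s * z (t - s)) := by ring
        _ = _ := by rw [e, one_mul]
    rw [h4]
    linarith [sq_nonneg (x t)]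
  rw [hgk]
  refine ⟨⟨fun h => ?_, case1⟩, ⟨?_, case2⟩, ⟨fun h => ?_, case3⟩⟩
  · rcases lt_trichotomy (∫ s, k s) 1 with h' | h' | h'
    · exact h'
    · obtain ⟨c, hc, hlim⟩ := case2 h'
      exact absurd (tendsto_nhds_unique h hlim) hc.ne
    · exact absurd h (not_tendsto_nhds_of_tendsto_atTop (case3 h') 0)
  · rintro ⟨c, hc, h⟩
    rcases lt_trichotomy (∫ s, k s) 1 with h' | h' | h'
    · exact absurd (tendsto_nhds_unique h (case1 h')) hc.ne'
    · exact h'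
    · exact absurd h (not_tendsto_nhds_of_tendsto_atTop (case3 h') c)
  · rcases lt_trichotomy (∫ s, k s) 1 with h' | h' | h'
    · exact absurd (case1 h') (not_tendsto_nhds_of_tendsto_atTop h 0)
    · obtain ⟨c, hc, hlim⟩ := case2 h'
      exact absurd hlim (not_tendsto_nhds_of_tendsto_atTop h c)
    · exact h'
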